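/- arXiv:2407.05827 — 2 statements merged into one kernel-verified Lean document; each statement's English description precedes it below -/
import Mathlib

section
/- Every oriented graph D satisfies χ⃗(D) ≤ max(2, Δ_min(D)), where Δ_min(D) = max_v min(d⁺(v), d⁻(v)). -/
open Relation

noncomputable def outDeg {V : Type*} (A : V → V → Prop) (v : V) : ℕ := {u | A v u}.ncard

noncomputable def inDeg {V : Type*} (A : V → V → Prop) (v : V) : ℕ := {u | A u v}.ncard

def IsDicol {V : Type*} (A : V → V → Prop) {k : ℕ} (c : V → Fin k) : Prop :=
  ∀ v, ¬ TransGen (fun x y => A x y ∧ c x = c y) v v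

noncomputable def dichrom {V : Type*} (A : V → V → Prop) : ℕ :=
  sInf {k | ∃ c : V → Fin k, IsDicol A c}

/-- No monochromatic directed cycle avoids `S`, witnessed by a rank increasing along arcs. -/
def AcyclicOff {V K : Type*} (B : V → V → Prop) (c : V → K) (S : Set V) : Prop :=
  ∃ r : V → ℕ, ∀ x y, x ∉ S → y ∉ S → B x y → c x = c y → r x < r y

/-- Whenever `c` is acyclic off `v`, every colour occurs exactly once among the out-neighbours
of `v` and exactly once among its in-neighbours. -/
def RainbowNbrs {V : Type*} (B : V → V → Prop) (K : Type*) : Prop :=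
  ∀ (c : V → K) (v : V), AcyclicOff B c {v} → ∀ i,
    (∃! w, B v w ∧ c w = i) ∧ (∃! w, B w v ∧ c w = i)

section AcyclicOff

variable {V K : Type*} {B : V → V → Prop} {c : V → K} {S : Set V} {v w : V}

lemma AcyclicOff.mono {T : Set V} (h : AcyclicOff B c S) (hST : S ⊆ T) : AcyclicOff B c T := by
  obtain ⟨r, hr⟩ := h
  exact ⟨r, fun x y hx hy => hr x y (fun h => hx (hST h)) (fun h => hy (hST h))⟩

lemma AcyclicOff.update [DecidableEq V] (h : AcyclicOff B c {v}) (i : K) :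
    AcyclicOff B (Function.update c v i) {v} := by
  obtain ⟨r, hr⟩ := h
  refine ⟨r, fun x y hx hy hB he => hr x y hx hy hB ?_⟩
  rwa [Function.update_of_ne hx, Function.update_of_ne hy] at he

lemma AcyclicOff.of_insert_of_out [Finite V] (h : AcyclicOff B c (insert v S))
    (hv : ∀ y, y ∉ S → B v y → c v ≠ c y) : AcyclicOff B c S := by
  classical
  obtain ⟨r, hr⟩ := h
  obtain ⟨M, hM⟩ := (Set.finite_range r).bddAbove
  refine ⟨Function.update r v (M + 1), fun x y hx hy hB he => ?_⟩
  by_cases hxv : x = v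
  · subst hxv
    exact absurd he (hv y hy hB)
  rw [Function.update_of_ne hxv]
  by_cases hyv : y = v
  · subst hyv
    rw [Function.update_self]
    exact Nat.lt_succ_of_le (hM ⟨x, rfl⟩)
  rw [Function.update_of_ne hyv]
  exact hr x y (by simp [hxv, hx]) (by simp [hyv, hy]) hB he

lemma AcyclicOff.of_insert_of_in (h : AcyclicOff B c (insert v S))
    (hv : ∀ y, y ∉ S → B y v → c y ≠ c v) : AcyclicOff B c S := by
  classical
  obtain ⟨r, hr⟩ := h
  refine ⟨Function.update (fun x => r x + 1) v 0, fun x y hx hy hB he => ?_⟩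
  by_cases hyv : y = v
  · subst hyv
    exact absurd he (hv x hx hB)
  rw [Function.update_of_ne hyv]
  by_cases hxv : x = v
  · subst hxv
    simp
  rw [Function.update_of_ne hxv]
  exact Nat.succ_lt_succ (hr x y (by simp [hxv, hx]) (by simp [hyv, hy]) hB he)

lemma RainbowNbrs.out_unique {u : V} (hB : RainbowNbrs B K) (h : AcyclicOff B c {v})
    (hu : B v u) (hw : B v w) (he : c u = c w) : u = w :=
  (hB c v h (c w)).1.unique ⟨hu, he⟩ ⟨hw, rfl⟩

lemma RainbowNbrs.in_unique {u : V} (hB : RainbowNbrs B K) (h : AcyclicOff B c {v})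
    (hu : B u v) (hw : B w v) (he : c u = c w) : u = w :=
  (hB c v h (c w)).2.unique ⟨hu, he⟩ ⟨hw, rfl⟩

lemma RainbowNbrs.acyclicOff_succ [Finite V] (hB : RainbowNbrs B K) (h : AcyclicOff B c {v})
    (hw : B v w) (he : c w = c v) : AcyclicOff B c {w} := by
  refine (h.mono (T := insert v {w}) (by simp)).of_insert_of_out fun y hy hvy hc => hy ?_
  exact hB.out_unique h hvy hw (by rw [← hc, he])

lemma RainbowNbrs.acyclicOff_pred (hB : RainbowNbrs B K) (h : AcyclicOff B c {v})
    (hw : B w v) (he : c w = c v) : AcyclicOff B c {w} := by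
  refine (h.mono (T := insert v {w}) (by simp)).of_insert_of_in fun y hy hvy hc => hy ?_
  exact hB.in_unique h hvy hw (by rw [hc, he])

end AcyclicOff

section Walk

variable {V K : Type*} [Finite V] [Finite K] [DecidableEq V] {B : V → V → Prop}

/-- Recolour the uncoloured vertex by `σ` and pass to its successor in the new class; this is
injective on states, hence periodic. -/
lemma RainbowNbrs.exists_walk (hB : RainbowNbrs B K) (σ : K → K)
    (hσ : Function.Involutive σ) (c : V → K) (v : V) (hc : AcyclicOff B c {v}) :
    ∃ (cs : ℕ → V → K) (vs : ℕ → V), cs 0 = c ∧ vs 0 = v ∧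
      (∀ t, AcyclicOff B (cs t) {vs t}) ∧
      (∀ t, cs (t + 1) = Function.update (cs t) (vs t) (σ (cs t (vs t)))) ∧
      (∀ t, B (vs t) (vs (t + 1))) ∧
      (∀ t, cs (t + 1) (vs (t + 1)) = cs (t + 1) (vs t)) ∧
      ∃ N, cs (N + 1) = c := by
  have hex : ∀ s : {s : (V → K) × V // AcyclicOff B s.1 {s.2}},
      ∃ s' : {s : (V → K) × V // AcyclicOff B s.1 {s.2}},
        s'.1.1 = Function.update s.1.1 s.1.2 (σ (s.1.1 s.1.2)) ∧ B s.1.2 s'.1.2 ∧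
        s'.1.1 s'.1.2 = s'.1.1 s.1.2 := by
    rintro ⟨⟨c, v⟩, hc⟩
    have hc' := hc.update (σ (c v))
    obtain ⟨w, ⟨hw, he⟩, -⟩ := (hB _ _ hc' (σ (c v))).1
    have he' : Function.update c v (σ (c v)) w = Function.update c v (σ (c v)) v := by
      rw [he, Function.update_self]
    exact ⟨⟨⟨_, w⟩, hB.acyclicOff_succ hc' hw he'⟩, rfl, hw, he'⟩
  choose step hcol harc hclass using hex
  have hinj : Function.Injective step := by
    rintro s t hst
    have hs := hclass s
    have ht := hclass t
    have hsB := harc s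
    have htB := harc t
    have hsc := hcol s
    have htc := hcol t
    rw [hst] at hs hsB hsc
    have hv : s.1.2 = t.1.2 := hB.in_unique (step t).2 hsB htB (by rw [← hs, ht])
    have hcc : s.1.1 = t.1.1 := by
      rw [hsc, hv] at htc
      funext x
      have hx := congrFun htc x
      by_cases hxv : x = t.1.2
      · subst hxv
        rw [Function.update_self, Function.update_self] at hx
        exact hσ.injective hx
      · rwa [Function.update_of_ne hxv, Function.update_of_ne hxv] at hx
    exact Subtype.ext (Prod.ext hcc hv)
  let s₀ : {s : (V → K) × V // AcyclicOff B s.1 {s.2}} := ⟨(c, v), hc⟩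
  have hsucc : ∀ t, step^[t + 1] s₀ = step (step^[t] s₀) := fun t =>
    Function.iterate_succ_apply' step t s₀
  refine ⟨fun t => (step^[t] s₀).1.1, fun t => (step^[t] s₀).1.2, rfl, rfl,
    fun t => (step^[t] s₀).2, fun t => ?_, fun t => ?_, fun t => ?_, ?_⟩
  · simp only [hsucc]; exact hcol _
  · simp only [hsucc]; exact harc _
  · simp only [hsucc]; exact hclass _
  · obtain ⟨N, hN, hper⟩ := hinj.mem_periodicPts s₀
    refine ⟨N - 1, ?_⟩
    rw [Nat.sub_add_cancel hN]
    show (step^[N] s₀).1.1 = c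
    rw [hper.eq]

end Walk

section Walk

variable {V K : Type*} [DecidableEq V] {B : V → V → Prop}

lemma walk_colour_of_notMem {cs : ℕ → V → K} {vs : ℕ → V} {σ : K → K}
    (hcs : ∀ t, cs (t + 1) = Function.update (cs t) (vs t) (σ (cs t (vs t)))) {t : ℕ} {x : V}
    (hx : ∀ j < t, vs j ≠ x) : cs t x = cs 0 x := by
  induction t with
  | zero => rfl
  | succ t ih =>
    rw [hcs, Function.update_of_ne (hx t t.lt_succ_self).symm]
    exact ih fun j hj => hx j (by omega)

lemma walk_colour_of_lt {cs : ℕ → V → K} {vs : ℕ → V} {σ : K → K}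
    (hcs : ∀ t, cs (t + 1) = Function.update (cs t) (vs t) (σ (cs t (vs t)))) {t i : ℕ}
    (hinj : Set.InjOn vs (Set.Iio t)) (hi : i < t) : cs t (vs i) = σ (cs 0 (vs i)) := by
  induction t with
  | zero => omega
  | succ t ih =>
    have hne : ∀ {i j}, i < t + 1 → j < t + 1 → i ≠ j → vs i ≠ vs j :=
      fun hi hj hij h => hij (hinj hi hj h)
    rcases Nat.lt_succ_iff_lt_or_eq.mp hi with h | rfl
    · rw [hcs, Function.update_of_ne (hne hi t.lt_succ_self h.ne)]
      exact ih (hinj.mono fun j (hj : j < t) => Set.mem_Iio.2 (by omega)) h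
    · rw [hcs, Function.update_self, walk_colour_of_notMem hcs]
      exact fun j hj => hne (by omega) (by omega) hj.ne

/-- As long as the walk does not use the predecessor of its start, its vertices are distinct. -/
lemma RainbowNbrs.walk_injOn (hB : RainbowNbrs B K) (hirr : ∀ v, ¬ B v v)
    {cs : ℕ → V → K} {vs : ℕ → V} {σ : K → K}
    (hσ : Function.Involutive σ) (hacyc : ∀ t, AcyclicOff B (cs t) {vs t})
    (hcs : ∀ t, cs (t + 1) = Function.update (cs t) (vs t) (σ (cs t (vs t))))
    (harc : ∀ t, B (vs t) (vs (t + 1)))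
    (hclass : ∀ t, cs (t + 1) (vs (t + 1)) = cs (t + 1) (vs t)) {p : V} {n : ℕ}
    (hp : B p (vs 0)) (hcp : cs 0 p = cs 0 (vs 0)) (hn : ∀ t ≤ n, vs t ≠ p) :
    Set.InjOn vs (Set.Iio (n + 1)) := by
  suffices h : ∀ t ≤ n + 1, Set.InjOn vs (Set.Iio t) from h _ le_rfl
  intro t
  induction t with
  | zero => intro _ x hx; simp at hx
  | succ t ih =>
    intro ht
    have ih := ih (by omega)
    suffices hnew : ∀ r < t, vs t ≠ vs r by
      intro i hi j hj hij
      rw [Set.mem_Iio] at hi hj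
      rcases Nat.lt_succ_iff_lt_or_eq.mp hi with hi' | rfl <;>
        rcases Nat.lt_succ_iff_lt_or_eq.mp hj with hj' | rfl
      · exact ih hi' hj' hij
      · exact absurd hij.symm (hnew _ hi')
      · exact absurd hij (hnew _ hj')
      · rfl
    intro r hr heq
    obtain ⟨s, rfl⟩ : ∃ s, t = s + 1 := ⟨t - 1, by omega⟩
    have hne : ∀ {i j}, i < s + 1 → j < s + 1 → i ≠ j → vs i ≠ vs j :=
      fun hi hj hij h => hij (ih hi hj h)
    have hcol : cs 0 (vs s) = cs 0 (vs r) := by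
      have h := hclass s
      rw [heq, walk_colour_of_lt hcs ih hr, walk_colour_of_lt hcs ih s.lt_succ_self] at h
      exact (hσ.injective h).symm
    have hsr : B (vs s) (vs r) := heq ▸ harc s
    have hrs : r ≠ s := by
      rintro rfl
      exact hirr _ hsr
    have hcolr : cs r (vs s) = cs r (vs r) := by
      rw [walk_colour_of_notMem hcs (x := vs s) fun j hj => hne (by omega) (by omega) (by omega),
        walk_colour_of_notMem hcs (x := vs r) fun j hj => hne (by omega) (by omega) (by omega),
        hcol]
    rcases r with _ | r
    · exact hn s (by omega) (hB.in_unique (hacyc 0) hsr hp (by rw [hcolr, hcp]))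
    · exact hne (i := s) (j := r) (by omega) (by omega) (by omega)
        (hB.in_unique (hacyc (r + 1)) hsr (harc r) (by rw [hcolr, hclass]))

end Walk

section Brooks

variable {V K : Type*} [Finite V] {B : V → V → Prop}

/-- A path `p → v → q` of one class cannot be bypassed through another class. -/
lemma RainbowNbrs.no_bypass (hB : RainbowNbrs B K) {c : V → K} {v p q w : V}
    (hc : AcyclicOff B c {v}) (hpv : B p v) (hvq : B v q) (hcp : c p = c v) (hcq : c q = c v)
    (hpq : p ≠ q) (hvp : v ≠ p) (hcw : c w ≠ c v) (hpw : B p w) (hwq : B w q) : False := by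
  classical
  have hwp : w ≠ p := by rintro rfl; exact hcw hcp
  have hqw : q ≠ w := by rintro rfl; exact hcw hcq
  have hvw : v ≠ w := by rintro rfl; exact hcw rfl
  have h1 := (hB.acyclicOff_pred hc hpv hcp).update (c w)
  have h2 := (hB.acyclicOff_succ h1 hpw (by simp [hwp])).update (c v)
  have h3 := hB.acyclicOff_succ h2 hwq (by simp [hqw, hpq.symm, hcq])
  exact hvw (hB.in_unique h3 hvq hwq (by simp [hvw, hvp]))

/-- The monochromatic cycle created by colouring the last vertex is a digon. -/
lemma RainbowNbrs.pred_eq_succ [Finite K] [Nontrivial K] (hB : RainbowNbrs B K) (hirr : ∀ v, ¬ B v v)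
    {c : V → K} {v p q : V} (hc : AcyclicOff B c {v}) (hpv : B p v) (hvq : B v q)
    (hcp : c p = c v) (hcq : c q = c v) : p = q := by
  classical
  by_contra hpq
  obtain ⟨b, hb⟩ := exists_ne (c v)
  have hvp : v ≠ p := by rintro rfl; exact hirr _ hpv
  have hqv : q ≠ v := by rintro rfl; exact hirr _ hvq
  obtain ⟨cs, vs, h0, hv0, hacyc, hcs, harc, hclass, N, hN⟩ :=
    hB.exists_walk (Equiv.swap (c v) b) (fun x => Equiv.swap_apply_self _ _ x) c v hc
  let M : Set V := {x | x ≠ v ∧ c x = c v ∧ AcyclicOff B c {x}}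
  have hpM : p ∈ M := ⟨hvp.symm, hcp, hB.acyclicOff_pred hc hpv hcp⟩
  have hqM : q ∈ M := ⟨hqv, hcq, hB.acyclicOff_succ hc hvq hcq⟩
  have hmeet : ∃ n, ∃ x ∈ M, AcyclicOff B (cs (n + 1)) {x} := ⟨N, q, hqM, hN ▸ hqM.2.2⟩
  obtain ⟨n, ⟨x₀, hx₀M, hx₀⟩, hmin⟩ : ∃ n, (∃ x ∈ M, AcyclicOff B (cs (n + 1)) {x}) ∧
      ∀ t < n, ∀ x ∈ M, ¬ AcyclicOff B (cs (t + 1)) {x} :=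
    ⟨Nat.find hmeet, Nat.find_spec hmeet, fun t ht x hx h => Nat.find_min hmeet ht ⟨x, hx, h⟩⟩
  have hvsM : ∀ t ≤ n, vs t ∉ M := by
    intro t ht hmem
    rcases t with _ | t
    · exact hmem.1 hv0
    · exact hmin t (by omega) _ hmem (hacyc _)
  have hcolM : ∀ t ≤ n + 1, ∀ x ∈ M, cs t x = c v := by
    intro t ht x hx
    rw [walk_colour_of_notMem hcs, h0, hx.2.1]
    rintro j hj rfl
    exact hvsM j (by omega) hx
  have hinj : Set.InjOn vs (Set.Iio (n + 1)) :=
    hB.walk_injOn hirr (fun x => Equiv.swap_apply_self _ _ x) hacyc hcs harc hclass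
      (hv0.symm ▸ hpv) (by rw [h0, hv0, hcp]) fun t ht h => hvsM t ht (h ▸ hpM)
  obtain ⟨r, hr⟩ := hc
  have hc : AcyclicOff B c {v} := ⟨r, hr⟩
  have hfin : (M ∩ {x | AcyclicOff B (cs (n + 1)) {x}}).Finite := Set.toFinite _
  have hp' : AcyclicOff B (cs (n + 1)) {p} := by
    obtain ⟨x, ⟨hxM, hx⟩, hmax⟩ := Set.exists_max_image _ r hfin ⟨x₀, hx₀M, hx₀⟩
    obtain ⟨y, ⟨hxy, hcy⟩, -⟩ := (hB c x hxM.2.2 (c x)).1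
    by_cases hyv : y = v
    · rwa [← hB.in_unique hc (hyv ▸ hxy) hpv (by rw [hxM.2.1, hcp])]
    have hyM : y ∈ M := ⟨hyv, hcy.trans hxM.2.1, hB.acyclicOff_succ hxM.2.2 hxy hcy⟩
    have hy := hB.acyclicOff_succ hx hxy (by rw [hcolM _ le_rfl y hyM, hcolM _ le_rfl x hxM])
    exact absurd (hr x y hxM.1 hyv hxy hcy.symm) (hmax y ⟨hyM, hy⟩).not_gt
  have hq' : AcyclicOff B (cs (n + 1)) {q} := by
    obtain ⟨x, ⟨hxM, hx⟩, hmax⟩ := Set.exists_min_image _ r hfin ⟨x₀, hx₀M, hx₀⟩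
    obtain ⟨y, ⟨hxy, hcy⟩, -⟩ := (hB c x hxM.2.2 (c x)).2
    by_cases hyv : y = v
    · rwa [← hB.out_unique hc (hyv ▸ hxy) hvq (by rw [hxM.2.1, hcq])]
    have hyM : y ∈ M := ⟨hyv, hcy.trans hxM.2.1, hB.acyclicOff_pred hxM.2.2 hxy hcy⟩
    have hy := hB.acyclicOff_pred hx hxy (by rw [hcolM _ le_rfl y hyM, hcolM _ le_rfl x hxM])
    exact absurd (hr y x hyv hxM.1 hxy hcy) (hmax y ⟨hyM, hy⟩).not_gt
  have hcv' : cs (n + 1) v = b := by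
    have h := walk_colour_of_lt hcs hinj n.succ_pos
    rwa [hv0, h0, Equiv.swap_apply_left] at h
  -- A vertex newly in the class of `v` that is adjacent to `p` or `q` has just been recoloured.
  have hlast : ∀ e, c e ≠ c v → cs (n + 1) e = c v →
      (∀ t < n, cs (t + 1) e = c v → ¬ AcyclicOff B (cs (t + 1)) {e}) → e = vs n := by
    intro e hce hce' hnot
    obtain ⟨τ, hτ, rfl⟩ : ∃ τ < n + 1, vs τ = e := by
      by_contra! h
      rw [walk_colour_of_notMem hcs h, h0] at hce'
      exact hce hce'
    rcases Nat.lt_succ_iff_lt_or_eq.mp hτ with hlt | rfl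
    · have hinj' := hinj.mono fun j (hj : j < τ + 1) => Set.mem_Iio.2 (show j < n + 1 by omega)
      have hcol := walk_colour_of_lt hcs hinj' τ.lt_succ_self
      rw [← walk_colour_of_lt hcs hinj hτ, hce'] at hcol
      refine absurd ?_ (hnot τ hlt hcol)
      rw [hcs]
      exact (hacyc τ).update _
    · rfl
  obtain ⟨e, ⟨hpe, hce⟩, -⟩ := (hB _ p hp' (c v)).1
  obtain ⟨u, ⟨huq, hcu⟩, -⟩ := (hB _ q hq' (c v)).2
  have hev : e ≠ v := by rintro rfl; exact hb (hcv'.symm.trans hce)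
  have huv : u ≠ v := by rintro rfl; exact hb (hcv'.symm.trans hcu)
  have hce0 : c e ≠ c v := fun h => hev (hB.out_unique hpM.2.2 hpe hpv h)
  have hcu0 : c u ≠ c v := fun h => huv (hB.in_unique hqM.2.2 huq hvq h)
  have he : e = vs n := hlast e hce0 hce fun t ht hcol hacyc_e =>
    hmin t ht p hpM (hB.acyclicOff_pred hacyc_e hpe (by rw [hcolM _ (by omega) p hpM, hcol]))
  have hu : u = vs n := hlast u hcu0 hcu fun t ht hcol hacyc_u =>
    hmin t ht q hqM (hB.acyclicOff_succ hacyc_u huq (by rw [hcolM _ (by omega) q hqM, hcol]))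
  subst he
  exact hB.no_bypass hc hpv hvq hcp hcq hpq hvp hce0 hpe (hu ▸ huq)

/-- If the digons form a bipartite graph, the neighbourhoods cannot all be rainbow. -/
lemma RainbowNbrs.not_acyclicOff [Finite K] [Nontrivial K] (hB : RainbowNbrs B K) (hirr : ∀ v, ¬ B v v)
    (f : V → Bool) (hf : ∀ u v, B u v → B v u → f u ≠ f v) (c : V → K) (v : V) :
    ¬ AcyclicOff B c {v} := by
  classical
  have := Fintype.ofFinite V
  obtain ⟨a, b, hab⟩ := exists_pair_ne K
  let enc : Bool → K := fun x => if x then a else b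
  have henc : ∀ x, enc (!x) ≠ enc x := by
    rintro (_ | _)
    · simpa [enc] using hab
    · simpa [enc] using hab.symm
  have main : ∀ (N : ℕ) (c : V → K) (v : V), AcyclicOff B c {v} → c v = enc (f v) →
      (Finset.univ.filter fun x => c x = enc (f x)).card ≤ N → False := by
    intro N
    induction N with
    | zero =>
      intro c v _ hv hN
      have : v ∈ Finset.univ.filter fun x => c x = enc (f x) := by simp [hv]
      rw [Finset.card_eq_zero.mp (Nat.le_zero.mp hN)] at this
      simp at this
    | succ N ih =>
      intro c v hc hv hN
      have hc' := hc.update (enc (!f v))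
      obtain ⟨w, ⟨hvw, hcw⟩, -⟩ := (hB _ _ hc' (enc (!f v))).1
      obtain ⟨u, ⟨huv, hcu⟩, -⟩ := (hB _ _ hc' (enc (!f v))).2
      have huw : u = w := hB.pred_eq_succ hirr hc' huv hvw (by simpa using hcu) (by simpa using hcw)
      subst huw
      have hfu : f u = !f v := by
        have := hf u v huv hvw
        cases h1 : f u <;> cases h2 : f v <;> simp_all
      refine ih _ u (hB.acyclicOff_succ hc' hvw (by simpa using hcw)) (by rw [hcu, hfu]) ?_
      refine Nat.le_of_lt_succ (lt_of_lt_of_le (Finset.card_lt_card ?_) hN)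
      refine Finset.ssubset_iff_of_subset (fun x hx => ?_) |>.mpr ⟨v, by simp [hv], ?_⟩
      · rw [Finset.mem_filter] at hx ⊢
        by_cases hxv : x = v
        · subst hxv
          simp [henc] at hx
        · simpa [hxv] using hx
      · simp [henc]
  intro hc
  exact main _ _ v (hc.update (enc (f v))) (by simp) le_rfl

end Brooks

section Degrees

variable {V : Type*} {B : V → V → Prop} {k : ℕ}

/-- Arcs between the two sides being symmetric, out- and in-degrees balance on each side. -/
lemma sum_outDeg_eq_sum_inDeg [Fintype V] (f : V → Bool)
    (hsymm : ∀ u v, f u ≠ f v → B u v → B v u) (s : Bool) :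
    ∑ x with f x = s, outDeg B x = ∑ x with f x = s, inDeg B x := by
  classical
  have hout : ∀ x, outDeg B x = (∑ y with f y = s, if B x y then 1 else 0) +
      ∑ y with ¬ f y = s, if B x y then 1 else 0 := by
    intro x
    rw [Finset.sum_filter_add_sum_filter_not, outDeg, Set.ncard_eq_toFinset_card']
    simp
  have hin : ∀ x, inDeg B x = (∑ y with f y = s, if B y x then 1 else 0) +
      ∑ y with ¬ f y = s, if B y x then 1 else 0 := by
    intro x
    rw [Finset.sum_filter_add_sum_filter_not, inDeg, Set.ncard_eq_toFinset_card']
    simp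
  simp only [hout, hin, Finset.sum_add_distrib]
  congr 1
  · exact Finset.sum_comm
  · refine Finset.sum_congr rfl fun x hx => Finset.sum_congr rfl fun y hy => ?_
    simp only [Finset.mem_filter, Finset.mem_univ, true_and] at hx hy
    have hxy : f x ≠ f y := fun h => hy (h ▸ hx)
    exact if_congr ⟨hsymm x y hxy, hsymm y x hxy.symm⟩ rfl rfl

lemma outDeg_eq_and_inDeg_eq [Finite V] (f : V → Bool)
    (hsymm : ∀ u v, f u ≠ f v → B u v → B v u)
    (hout : ∀ v, f v = true → outDeg B v ≤ k) (hin : ∀ v, f v = false → inDeg B v ≤ k)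
    (hout' : ∀ v, k ≤ outDeg B v) (hin' : ∀ v, k ≤ inDeg B v) (v : V) :
    outDeg B v = k ∧ inDeg B v = k := by
  have := Fintype.ofFinite V
  have htight : ∀ (s : Finset V) (g h : V → ℕ), (∀ x ∈ s, g x ≤ k) → (∀ x, k ≤ h x) →
      ∑ x ∈ s, g x = ∑ x ∈ s, h x → ∀ x ∈ s, h x = k := by
    intro s g h hg hh hsum
    have hle : ∀ x ∈ s, g x ≤ h x := fun x hx => (hg x hx).trans (hh x)
    have heq := (Finset.sum_eq_sum_iff_of_le hle).mp hsum
    exact fun x hx => le_antisymm (heq x hx ▸ hg x hx) (hh x)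
  cases hv : f v
  · exact ⟨htight _ (inDeg B) (outDeg B) (by simpa using hin) hout'
      (sum_outDeg_eq_sum_inDeg f hsymm false).symm v (by simpa using hv),
      le_antisymm (hin v hv) (hin' v)⟩
  · exact ⟨le_antisymm (hout v hv) (hout' v), htight _ (outDeg B) (inDeg B) (by simpa using hout)
      hin' (sum_outDeg_eq_sum_inDeg f hsymm true) v (by simpa using hv)⟩

/-- A set mapped onto `Fin k` has at least `k` elements, and if it has exactly `k`, the map is
injective on it. -/
lemma le_ncard_of_forall_exists [Finite V] {c : V → Fin k} {s : Set V} (h : ∀ i, ∃ w ∈ s, c w = i) :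
    k ≤ s.ncard ∧ (s.ncard = k → Set.InjOn c s) := by
  have himg : c '' s = Set.univ := Set.eq_univ_of_forall fun i => h i
  have hk : (c '' s).ncard = k := by rw [himg, Set.ncard_univ, Nat.card_fin]
  exact ⟨hk.symm.trans_le (Set.ncard_image_le s.toFinite),
    fun hs => Set.injOn_of_ncard_image_eq (hk.trans hs.symm) s.toFinite⟩

end Degrees

/-- A digraph split into two oriented sides joined by digons only, with out-degrees at most `k`
on one side and in-degrees at most `k` on the other, is `k`-dicolourable when `k ≥ 2`. -/
lemma exists_acyclicOff_empty {k : ℕ} (hk : 2 ≤ k) (n : ℕ) :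
    ∀ {V : Type*} [Finite V] (B : V → V → Prop) (f : V → Bool), Nat.card V = n →
      (∀ u v, f u = f v → B u v → ¬ B v u) → (∀ u v, f u ≠ f v → B u v → B v u) →
      (∀ v, f v = true → outDeg B v ≤ k) → (∀ v, f v = false → inDeg B v ≤ k) →
      ∃ c : V → Fin k, AcyclicOff B c ∅ := by
  induction n with
  | zero =>
    intro V _ B f hV _ _ _ _
    have := (Finite.card_eq_zero_iff (α := V)).mp hV
    exact ⟨isEmptyElim, isEmptyElim, isEmptyElim⟩
  | succ n ih =>
    intro V _ B f hV hor hsymm hout hin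
    classical
    by_contra hno
    have : Nontrivial (Fin k) := Fin.nontrivial_iff_two_le.mpr hk
    have hirr : ∀ v, ¬ B v v := fun v h => hor v v rfl h h
    have hdel : ∀ v, ∃ c : V → Fin k, AcyclicOff B c {v} := by
      intro v
      have hcard : Nat.card {u // u ≠ v} = n := by
        have := Set.ncard_add_ncard_compl {v}
        rw [Set.ncard_singleton, hV] at this
        have h2 : Nat.card {u // u ≠ v} = ({v}ᶜ : Set V).ncard := Nat.card_coe_set_eq _
        omega
      obtain ⟨c, r, hr⟩ := ih (V := {u // u ≠ v}) (fun x y => B x y) (fun x => f x) hcard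
        (fun x y => hor x y) (fun x y => hsymm x y)
        (fun x hx => le_trans (Set.ncard_le_ncard_of_injOn Subtype.val (fun y hy => hy)
          Subtype.val_injective.injOn (Set.toFinite _)) (hout x hx))
        (fun x hx => le_trans (Set.ncard_le_ncard_of_injOn Subtype.val (fun y hy => hy)
          Subtype.val_injective.injOn (Set.toFinite _)) (hin x hx))
      refine ⟨fun x => if h : x ≠ v then c ⟨x, h⟩ else ⟨0, by omega⟩,
        fun x => if h : x ≠ v then r ⟨x, h⟩ else 0, fun x y hx hy hB he => ?_⟩
      have hx' : x ≠ v := hx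
      have hy' : y ≠ v := hy
      simp only [dif_pos hx', dif_pos hy'] at he ⊢
      exact hr ⟨x, hx'⟩ ⟨y, hy'⟩ (by simp) (by simp) hB he
    have hexout : ∀ (c : V → Fin k) v, AcyclicOff B c {v} → ∀ i, ∃ w ∈ {w | B v w}, c w = i := by
      intro c v hc i
      by_contra! h
      refine hno ⟨_, AcyclicOff.of_insert_of_out (v := v) (by simpa using hc.update i) ?_⟩
      intro y _ hy
      have hyv : y ≠ v := by rintro rfl; exact hirr _ hy
      simpa [hyv] using (h y hy).symm
    have hexin : ∀ (c : V → Fin k) v, AcyclicOff B c {v} → ∀ i, ∃ w ∈ {w | B w v}, c w = i := by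
      intro c v hc i
      by_contra! h
      refine hno ⟨_, AcyclicOff.of_insert_of_in (v := v) (by simpa using hc.update i) ?_⟩
      intro y _ hy
      have hyv : y ≠ v := by rintro rfl; exact hirr _ hy
      simpa [hyv] using h y hy
    have hdeg := outDeg_eq_and_inDeg_eq f hsymm hout hin
      (fun v => (hdel v).elim fun c hc => (le_ncard_of_forall_exists (hexout c v hc)).1)
      (fun v => (hdel v).elim fun c hc => (le_ncard_of_forall_exists (hexin c v hc)).1)
    have hB : RainbowNbrs B (Fin k) := by
      intro c v hc i
      obtain ⟨w, hw, hcw⟩ := hexout c v hc i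
      obtain ⟨u, hu, hcu⟩ := hexin c v hc i
      exact ⟨⟨w, ⟨hw, hcw⟩, fun y hy => (le_ncard_of_forall_exists (hexout c v hc)).2 (hdeg v).1
          hy.1 hw (hy.2.trans hcw.symm)⟩,
        ⟨u, ⟨hu, hcu⟩, fun y hy => (le_ncard_of_forall_exists (hexin c v hc)).2 (hdeg v).2
          hy.1 hu (hy.2.trans hcu.symm)⟩⟩
    have hne : Nonempty V := (Nat.card_pos_iff.mp (by omega : 0 < Nat.card V)).1
    obtain ⟨v⟩ := hne
    obtain ⟨c, hc⟩ := hdel v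
    exact hB.not_acyclicOff hirr f (fun u v huv hvu h => hor u v h huv hvu) c v hc

theorem stmt_11 {V : Type*} [Fintype V] (A : V → V → Prop)
    (horiented : ∀ u v, A u v → ¬ A v u) :
    dichrom A ≤ max 2 (Finset.univ.sup fun v => min (outDeg A v) (inDeg A v)) := by
  classical
  set k := max 2 (Finset.univ.sup fun v => min (outDeg A v) (inDeg A v))
  have hmin : ∀ v, min (outDeg A v) (inDeg A v) ≤ k := fun v =>
    (Finset.le_sup (f := fun v => min (outDeg A v) (inDeg A v)) (Finset.mem_univ v)).trans
      (le_max_right _ _)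
  let f : V → Bool := fun v => decide (outDeg A v ≤ k)
  -- Drop the arcs from side `false` to side `true` and make the arcs in the other direction digons.
  let B : V → V → Prop := fun x y =>
    (f x = f y ∧ A x y) ∨ (f x = true ∧ f y = false ∧ A x y) ∨ (f x = false ∧ f y = true ∧ A y x)
  obtain ⟨c, r, hr⟩ := exists_acyclicOff_empty (k := k) (le_max_left _ _) (Nat.card V) B f rfl
    (by
      intro u v hf huv hvu
      have h1 : A u v := by rcases huv with h | h | h <;> simp_all
      have h2 : A v u := by rcases hvu with h | h | h <;> simp_all
      exact horiented u v h1 h2)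
    (by
      intro u v hf huv
      rcases huv with h | h | h
      · exact absurd h.1 hf
      · exact Or.inr (Or.inr ⟨h.2.1, h.1, h.2.2⟩)
      · exact Or.inr (Or.inl ⟨h.2.1, h.1, h.2.2⟩))
    (by
      intro v hv
      refine (Set.ncard_le_ncard (fun u hu => ?_) (Set.toFinite _)).trans (of_decide_eq_true hv)
      rcases hu with h | h | h
      · exact h.2
      · exact h.2.2
      · simp_all)
    (by
      intro v hv
      have hin : inDeg A v ≤ k :=
        (min_le_iff.mp (hmin v)).resolve_left (of_decide_eq_false hv)
      refine (Set.ncard_le_ncard (fun u hu => ?_) (Set.toFinite _)).trans hin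
      rcases hu with h | h | h
      · exact h.2
      · exact h.2.2
      · simp_all)
  refine Nat.sInf_le ⟨c, fun v hv => ?_⟩
  have hlt : ∀ x y, A x y ∧ c x = c y → toLex (f x, r x) < toLex (f y, r y) := by
    rintro x y ⟨hxy, hc⟩
    rw [Prod.Lex.toLex_lt_toLex]
    cases hx : f x <;> cases hy : f y
    · exact Or.inr ⟨rfl, hr x y (by simp) (by simp) (Or.inl ⟨hx.trans hy.symm, hxy⟩) hc⟩
    · exact Or.inl (by simp)
    · have h1 := hr x y (by simp) (by simp) (Or.inr (Or.inl ⟨hx, hy, hxy⟩)) hc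
      have h2 := hr y x (by simp) (by simp) (Or.inr (Or.inr ⟨hy, hx, hxy⟩)) hc.symm
      omega
    · exact Or.inr ⟨rfl, hr x y (by simp) (by simp) (Or.inl ⟨hx.trans hy.symm, hxy⟩) hc⟩
  have htrans : ∀ {x y}, TransGen (fun x y => A x y ∧ c x = c y) x y →
      toLex (f x, r x) < toLex (f y, r y) := by
    intro x y h
    induction h with
    | single h => exact hlt _ _ h
    | tail _ h ih => exact ih.trans (hlt _ _ h)
  exact lt_irrefl _ (htrans hv)
end

section
/- Let D be a connected digraph and Δ an integer with Δ_max(D) ≤ Δ and ω⃡(D) > (2/3)(Δ+1). Then D has an acyclic set of vertices I such that ω⃡(D − I) = ω⃡(D) − 1. -/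
open Relation

def AcyclicOn {V : Type*} (A : V → V → Prop) (S : Set V) : Prop :=
  ∀ v, ¬ TransGen (fun x y => x ∈ S ∧ y ∈ S ∧ A x y) v v

/-- The biclique number: size of a largest set of vertices inducing a complete digraph. -/
noncomputable def bicliqueNum {V : Type*} (A : V → V → Prop) : ℕ :=
  sSup {m | ∃ S : Finset V, (∀ u ∈ S, ∀ w ∈ S, u ≠ w → A u w) ∧ S.card = m}

/-- The biclique number of the subdigraph obtained by deleting the vertex set `I`. -/
noncomputable def bicliqueNumOutside {V : Type*} (A : V → V → Prop) (I : Set V) : ℕ :=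
  sSup {m | ∃ S : Finset V, (∀ u ∈ S, ∀ w ∈ S, u ≠ w → A u w) ∧
    (∀ v ∈ S, v ∉ I) ∧ S.card = m}

section AcyclicTransversal

open Finset Function

variable {V ι : Type*}

lemma AcyclicOn.insert_sink {R : V → V → Prop} {S : Set V} {y : V} (hS : AcyclicOn R S)
    (hy : ¬ R y y) (hyS : ∀ t ∈ S, ¬ R y t) : AcyclicOn R (insert y S) := by
  have hsink : ∀ b ∈ insert y S, ¬ R y b := by
    rintro b (rfl | hb)
    exacts [hy, hyS b hb]
  have key : ∀ a b : V,
      TransGen (fun x z => x ∈ insert y S ∧ z ∈ insert y S ∧ R x z) a b → b ≠ y →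
      TransGen (fun x z => x ∈ S ∧ z ∈ S ∧ R x z) a b := by
    intro a b h
    induction h with
    | single h =>
      intro hb
      obtain ⟨ha, hb', hr⟩ := h
      refine TransGen.single ⟨ha.resolve_left ?_, hb'.resolve_left hb, hr⟩
      rintro rfl
      exact hsink _ hb' hr
    | @tail b c _ h ih =>
      intro hc
      obtain ⟨hb, hc', hr⟩ := h
      have hby : b ≠ y := by
        rintro rfl
        exact hsink _ hc' hr
      exact (ih hby).tail ⟨hb.resolve_left hby, hc'.resolve_left hc, hr⟩
  intro v hv
  refine hS v (key v v hv ?_)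
  rintro rfl
  obtain ⟨c, ⟨_, hc, hr⟩, _⟩ := TransGen.head'_iff.1 hv
  exact hsink c hc hr

lemma AcyclicOn.mono {R : V → V → Prop} {S T : Set V} (hT : AcyclicOn R T) (h : S ⊆ T) :
    AcyclicOn R S := fun v hv =>
  hT v (TransGen.mono (fun _ _ ⟨hx, hy, hr⟩ => ⟨h hx, h hy, hr⟩) _ _ hv)

lemma AcyclicOn.update_sink [DecidableEq ι] {R : V → V → Prop} {f : ι → V} {s t : Set ι} {i : ι}
    {y : V} (hf : AcyclicOn R (f '' s)) (hts : t ⊆ insert i s) (hy : ¬ R y y)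
    (hys : ∀ j ∈ s, ¬ R y (f j)) : AcyclicOn R (update f i y '' t) := by
  refine (hf.insert_sink hy ?_).mono ?_
  · rintro _ ⟨j, hj, rfl⟩
    exact hys j hj
  · rintro _ ⟨j, hj, rfl⟩
    by_cases hji : j = i
    · subst hji
      simp
    · rw [update_of_ne hji]
      exact Or.inr ⟨j, (hts hj).resolve_left hji, rfl⟩

/-- The system of representatives `f` is acyclic, is hit by the out-neighbourhood of `X` exactly
in the classes of `J`, and agrees with `g` there. -/
structure CompatibleTransversal (R : V → V → Prop) (F : ι → Finset V) (s : Finset ι)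
    (X : Finset V) (J : Finset ι) (g f : ι → V) : Prop where
  mem : ∀ i ∈ s, f i ∈ F i
  acyclic : AcyclicOn R (f '' s)
  hit_iff : ∀ i ∈ s, (∃ x ∈ X, R x (f i)) ↔ i ∈ J
  agree : ∀ i ∈ J, f i = g i

open Classical in
lemma exists_undominated [Fintype V] {R : V → V → Prop} {F : ι → Finset V} {k : ℕ} {a : ι}
    {J : Finset ι} {X : Finset V} {g : ι → V} (haJ : a ∉ J)
    (hdisj : ((insert a J : Finset ι) : Set ι).PairwiseDisjoint F) (hne : (F a).Nonempty)
    (hout : ∀ x ∈ X, #{u | R x u} ≤ k) (hin : ∀ j ∈ J, #{u | R u (g j)} + k ≤ #(F j))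
    (hX : #X ≤ #J) :
    ∃ i ∈ insert a J, ∃ y ∈ F i, (∀ x ∈ X, ¬ R x y) ∧ ∀ j ∈ J, ¬ R y (g j) := by
  by_contra! hcon
  have hsub : (insert a J).biUnion F ⊆
      X.biUnion (fun x => {u | R x u}) ∪ J.biUnion (fun j => {u | R u (g j)}) := by
    intro y hy
    obtain ⟨i, hi, hyi⟩ := mem_biUnion.1 hy
    by_cases h : ∃ x ∈ X, R x y
    · obtain ⟨x, hx, hr⟩ := h
      exact mem_union_left _ (mem_biUnion.2 ⟨x, hx, by simpa using hr⟩)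
    · push Not at h
      obtain ⟨j, hj, hr⟩ := hcon i hi y hyi h
      exact mem_union_right _ (mem_biUnion.2 ⟨j, hj, by simpa using hr⟩)
  have h₁ := (card_le_card hsub).trans (card_union_le _ _)
  rw [card_biUnion hdisj, sum_insert haJ] at h₁
  have h₂ := card_biUnion_le_card_mul X (fun x => ({u | R x u} : Finset V)) k hout
  have h₃ : #(J.biUnion fun j => ({u | R u (g j)} : Finset V)) ≤ _ := card_biUnion_le
  have h₄ := sum_le_sum hin
  rw [sum_add_distrib, sum_const, smul_eq_mul] at h₄
  have h₅ := Nat.mul_le_mul_right k hX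
  have h₆ := hne.card_pos
  omega

open Classical in
/-- A lopsided independent transversal theorem for digraphs. -/
theorem exists_acyclic_transversal [Fintype V] [Nonempty V] {R : V → V → Prop}
    (hirr : ∀ v, ¬ R v v) {F : ι → Finset V} {k : ℕ} (s : Finset ι)
    (hdisj : (s : Set ι).PairwiseDisjoint F) (hne : ∀ i ∈ s, (F i).Nonempty)
    (hout : ∀ i ∈ s, ∀ v ∈ F i, #{u | R v u} ≤ k)
    (hin : ∀ i ∈ s, ∀ v ∈ F i, #{u | R u v} + k ≤ #(F i)) :
    ∃ f : ι → V, (∀ i ∈ s, f i ∈ F i) ∧ AcyclicOn R (f '' s) := by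
  induction s using Finset.induction_on with
  | empty =>
    refine ⟨fun _ => Classical.arbitrary V, by simp, fun v hv => ?_⟩
    obtain ⟨c, ⟨h, _⟩, _⟩ := TransGen.head'_iff.1 hv
    simp at h
  | insert a s has ih =>
    obtain ⟨f₀, hf₀, hf₀'⟩ := ih
      (hdisj.subset (by simp))
      (fun i hi => hne i (mem_insert_of_mem hi)) (fun i hi => hout i (mem_insert_of_mem hi))
      (fun i hi => hin i (mem_insert_of_mem hi))
    by_contra hno
    have hstep : ∀ n : ℕ, ∃ (X : Finset V) (J : Finset ι) (g : ι → V), J ⊆ s ∧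
        CompatibleTransversal R F s X J g g ∧ #X ≤ #J ∧
        (∀ x ∈ X, #{u | R x u} ≤ k) ∧
        (∀ f, CompatibleTransversal R F s X J g f → ∀ j ∈ J, ∀ y ∈ F j,
          (∀ x ∈ X, ¬ R x y) → ¬ AcyclicOn R (update f j y '' s)) ∧ n ≤ #J := by
      intro n
      induction n with
      | zero => exact ⟨∅, ∅, f₀, by simp, ⟨hf₀, hf₀', by simp, by simp⟩, by simp⟩
      | succ n ihn =>
        obtain ⟨X, J, g, hJs, hg, hXJ, hXk, hswap, hn⟩ := ihn
        obtain ⟨i, hi, y, hyi, hXy, hyJ⟩ := exists_undominated (fun h => has (hJs h))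
          (hdisj.subset (by exact_mod_cast insert_subset_insert a hJs))
          (hne a (mem_insert_self _ _)) hXk
          (fun j hj => hin j (mem_insert_of_mem (hJs hj)) _ (hg.mem j (hJs hj))) hXJ
        -- choose a compatible `f` for which `y` has the fewest out-neighbours
        obtain ⟨f, hf, hmin⟩ : ∃ f, CompatibleTransversal R F s X J g f ∧
            ∀ f', CompatibleTransversal R F s X J g f' →
              #{i ∈ s | R y (f i)} ≤ #{i ∈ s | R y (f' i)} := by
          obtain ⟨f, hf, hmin⟩ := (measure fun f : ι → V => #{i ∈ s | R y (f i)}).wf.has_min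
            {f | CompatibleTransversal R F s X J g f} ⟨g, hg⟩
          exact ⟨f, hf, fun f' hf' => not_lt.1 (hmin f' hf')⟩
        set N : Finset ι := {i ∈ s | R y (f i)} with hN
        have hNJ : Disjoint J N := by
          refine disjoint_left.2 fun j hj hjN => hyJ j hj ?_
          rw [← hf.agree j hj]
          exact (mem_filter.1 hjN).2
        have hNne : N.Nonempty := by
          by_contra hemp
          have hsink : ∀ j ∈ (s : Set ι), ¬ R y (f j) := fun j hj hr =>
            hemp ⟨j, mem_filter.2 ⟨hj, hr⟩⟩
          rcases mem_insert.1 hi with rfl | hiJ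
          · refine hno ⟨update f i y, ?_,
              hf.acyclic.update_sink (by simp) (hirr y) hsink⟩
            intro j hj
            by_cases hji : j = i
            · subst hji
              simpa using hyi
            · rw [update_of_ne hji]
              exact hf.mem j ((mem_insert.1 hj).resolve_left hji)
          · exact hswap f hf i hiJ y hyi hXy
              (hf.acyclic.update_sink (Set.subset_insert _ _) (hirr y) hsink)
        have hrestrict : ∀ f', CompatibleTransversal R F s (insert y X) (J ∪ N) f f' →
            CompatibleTransversal R F s X J g f' := by
          intro f' hf'
          have hag : ∀ j ∈ J, f' j = g j := fun j hj =>
            (hf'.agree j (mem_union_left _ hj)).trans (hf.agree j hj)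
          refine ⟨hf'.mem, hf'.acyclic, fun j hj => ⟨?_, fun hjJ => ?_⟩, hag⟩
          · rintro ⟨x, hx, hr⟩
            have hjJN := (hf'.hit_iff j hj).1 ⟨x, mem_insert_of_mem hx, hr⟩
            rw [hf'.agree j hjJN] at hr
            exact (hf.hit_iff j hj).1 ⟨x, hx, hr⟩
          · rw [hag j hjJ, ← hf.agree j hjJ]
            exact (hf.hit_iff j hj).2 hjJ
        refine ⟨insert y X, J ∪ N, f, union_subset hJs (filter_subset _ _),
          ⟨hf.mem, hf.acyclic, fun j hj => ?_, fun _ _ => rfl⟩, ?_, ?_, ?_, ?_⟩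
        · rw [mem_union, ← hf.hit_iff j hj, hN, mem_filter]
          simp [hj, or_comm]
        · rw [card_union_of_disjoint hNJ]
          exact (card_insert_le _ _).trans (add_le_add hXJ hNne.card_pos)
        · intro x hx
          rcases mem_insert.1 hx with rfl | hx
          · exact hout i (insert_subset_insert a hJs hi) _ hyi
          · exact hXk x hx
        · intro f' hf' j hj z hz hXz hac
          have hf'' := hrestrict f' hf'
          rcases mem_union.1 hj with hjJ | hjN
          · exact hswap f' hf'' j hjJ z hz (fun x hx => hXz x (mem_insert_of_mem hx)) hac
          · have hjJ : j ∉ J := disjoint_right.1 hNJ hjN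
            have hcomp : CompatibleTransversal R F s X J g (update f' j z) := by
              refine ⟨fun l hl => ?_, hac, fun l hl => ?_, fun l hl => ?_⟩
              · by_cases hlj : l = j
                · subst hlj
                  simpa using hz
                · rw [update_of_ne hlj]
                  exact hf'.mem l hl
              · by_cases hlj : l = j
                · subst hlj
                  simp only [update_self, hjJ, iff_false, not_exists, not_and]
                  exact fun x hx => hXz x (mem_insert_of_mem hx)
                · rw [update_of_ne hlj]
                  exact hf''.hit_iff l hl
              · rw [update_of_ne (by rintro rfl; exact hjJ hl)]
                exact hf''.agree l hl
            refine (hmin _ hcomp).not_gt (card_lt_card ?_)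
            rw [ssubset_iff_of_subset]
            · refine ⟨j, hjN, ?_⟩
              simp only [mem_filter, update_self, not_and]
              exact fun _ => hXz y (mem_insert_self _ _)
            · intro l hl
              obtain ⟨hls, hr⟩ := mem_filter.1 hl
              by_cases hlj : l = j
              · exact hlj ▸ hjN
              · rw [update_of_ne hlj] at hr
                have hlJN := (hf'.hit_iff l hls).1 ⟨y, mem_insert_self _ _, hr⟩
                rw [hf'.agree l hlJN] at hr
                exact mem_filter.2 ⟨hls, hr⟩
        · rw [card_union_of_disjoint hNJ]
          exact add_le_add hn hNne.card_pos
    obtain ⟨X, J, g, hJs, -, -, -, -, hn⟩ := hstep (#s + 1)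
    have := card_le_card hJs
    omega

end AcyclicTransversal

section Bicliques

open Finset

variable {V : Type*} {A : V → V → Prop}

def IsBiclique (A : V → V → Prop) (S : Finset V) : Prop :=
  ∀ u ∈ S, ∀ w ∈ S, u ≠ w → A u w

lemma bddAbove_card_isBiclique [Fintype V] (A : V → V → Prop) :
    BddAbove {m | ∃ S : Finset V, IsBiclique A S ∧ #S = m} := by
  refine ⟨Fintype.card V, ?_⟩
  rintro _ ⟨S, _, rfl⟩
  exact card_le_univ S

lemma IsBiclique.card_le [Fintype V] {S : Finset V} (hS : IsBiclique A S) :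
    #S ≤ bicliqueNum A :=
  le_csSup (bddAbove_card_isBiclique A) ⟨S, hS, rfl⟩

lemma exists_isBiclique_card_eq [Fintype V] (A : V → V → Prop) :
    ∃ S, IsBiclique A S ∧ #S = bicliqueNum A :=
  Nat.sSup_mem (s := {m | ∃ S : Finset V, IsBiclique A S ∧ #S = m})
    ⟨0, ∅, by simp [IsBiclique], rfl⟩ (bddAbove_card_isBiclique A)

/-- A biclique of maximum size. -/
def IsMaxBiclique (A : V → V → Prop) (S : Finset V) : Prop :=
  IsBiclique A S ∧ #S = bicliqueNum A

open Classical in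
/-- The vertices lying in every member of a family. -/
noncomputable def commonPart [Fintype V] (C : Finset (Finset V)) : Finset V :=
  {v | ∀ Q ∈ C, v ∈ Q}

lemma mem_commonPart [Fintype V] {C : Finset (Finset V)} {v : V} :
    v ∈ commonPart C ↔ ∀ Q ∈ C, v ∈ Q := by
  simp [commonPart]

open Classical in
/-- Hajnal's inequality for maximum bicliques. -/
lemma two_mul_bicliqueNum_le [Fintype V] {C : Finset (Finset V)} (hC : C.Nonempty)
    (hmax : ∀ Q ∈ C, IsMaxBiclique A Q) :
    2 * bicliqueNum A ≤ #(commonPart C) + #(C.biUnion id) := by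
  induction hC using Finset.Nonempty.cons_induction with
  | singleton Q =>
    have hQ : commonPart {Q} = Q := by ext; simp [mem_commonPart]
    rw [hQ, singleton_biUnion, id, (hmax Q (by simp)).2]
    omega
  | cons Q C hQC hC ih =>
    have hmaxC : ∀ P ∈ C, IsMaxBiclique A P := fun P hP => hmax P (by simp [hP])
    have hQ := hmax Q (by simp)
    have ih := ih hmaxC
    have hcl : IsBiclique A ((Q ∩ C.biUnion id) ∪ commonPart C) := by
      have hU : ∀ u ∈ commonPart C, u ∈ C.biUnion id := fun u hu => by
        obtain ⟨P, hP⟩ := hC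
        exact mem_biUnion.2 ⟨P, hP, mem_commonPart.1 hu P hP⟩
      intro u hu w hw huw
      rcases mem_union.1 hu with hu | hu
      · rcases mem_union.1 hw with hw | hw
        · exact hQ.1 u (mem_inter.1 hu).1 w (mem_inter.1 hw).1 huw
        · obtain ⟨P, hP, huP⟩ := mem_biUnion.1 (mem_inter.1 hu).2
          exact (hmaxC P hP).1 u huP w (mem_commonPart.1 hw P hP) huw
      · have hwU : w ∈ C.biUnion id :=
          (mem_union.1 hw).elim (fun h => (mem_inter.1 h).2) (hU w)
        obtain ⟨P, hP, hwP⟩ := mem_biUnion.1 hwU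
        exact (hmaxC P hP).1 u (mem_commonPart.1 hu P hP) w hwP huw
    have h₁ := hcl.card_le
    have h₂ := card_union_add_card_inter (Q ∩ C.biUnion id) (commonPart C)
    have h₃ : #((Q ∩ C.biUnion id) ∩ commonPart C) ≤ #(commonPart (cons Q C hQC)) := by
      refine card_le_card fun v hv => ?_
      simp only [mem_inter, mem_commonPart] at hv
      simpa [mem_commonPart] using ⟨hv.1.1, hv.2⟩
    have h₄ := card_union_add_card_inter Q (C.biUnion id)
    have h₅ : (cons Q C hQC).biUnion id = Q ∪ C.biUnion id := by
      rw [cons_eq_insert, biUnion_insert, id]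
    rw [h₅]
    have := hQ.2
    omega

section Degree

variable [Fintype V] {Δ : ℕ}

open Classical in
lemma card_filter_out_le (hΔ : ∀ v, max (outDeg A v) (inDeg A v) ≤ Δ) (v : V) :
    #{u | A v u} ≤ Δ := by
  have := (le_max_left _ _).trans (hΔ v)
  rwa [outDeg, Set.ncard_eq_toFinset_card', Set.toFinset_ofPred] at this

open Classical in
lemma card_filter_in_le (hΔ : ∀ v, max (outDeg A v) (inDeg A v) ≤ Δ) (v : V) :
    #{u | A u v} ≤ Δ := by
  have := (le_max_right _ _).trans (hΔ v)
  rwa [inDeg, Set.ncard_eq_toFinset_card', Set.toFinset_ofPred] at this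

open Classical in
lemma card_add_card_biUnion_le {B : V → V → Prop} {v : V} (hB : #{u | B v u} ≤ Δ)
    {C : Finset (Finset V)} (hC : ∀ Q ∈ C, IsBiclique B Q) (hv : v ∈ commonPart C) {S : Finset V}
    (hS : ∀ u ∈ S, B v u ∧ u ∉ C.biUnion id) : #S + #(C.biUnion id) ≤ Δ + 1 := by
  have hdisj : Disjoint S (C.biUnion id) := disjoint_left.2 fun u hu => (hS u hu).2
  rw [← card_union_of_disjoint hdisj]
  have hsub : S ∪ C.biUnion id ⊆ insert v ({u | B v u} : Finset V) := by
    intro u hu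
    rw [mem_insert]
    by_cases huv : u = v
    · exact Or.inl huv
    right
    rcases mem_union.1 hu with hu | hu
    · simpa using (hS u hu).1
    · obtain ⟨Q, hQ, huQ⟩ := mem_biUnion.1 hu
      simpa using hC Q hQ v (mem_commonPart.1 hv Q hQ) u huQ (Ne.symm huv)
  exact (card_le_card hsub).trans ((card_insert_le _ _).trans (by omega))

lemma two_mul_bicliqueNum_le_card_commonPart (hΔ : ∀ v, max (outDeg A v) (inDeg A v) ≤ Δ)
    {C : Finset (Finset V)} (hC : C.Nonempty) (hmax : ∀ Q ∈ C, IsMaxBiclique A Q)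
    (hne : (commonPart C).Nonempty) :
    2 * bicliqueNum A ≤ #(commonPart C) + (Δ + 1) := by
  classical
  obtain ⟨v, hv⟩ := hne
  have h₁ := two_mul_bicliqueNum_le hC hmax
  have h₂ := card_add_card_biUnion_le (card_filter_out_le hΔ v) (fun Q hQ => (hmax Q hQ).1) hv
    (S := ∅) (by simp)
  rw [card_empty] at h₂
  omega

open Classical in
/-- Two large common parts inside one maximum biclique meet. -/
lemma commonPart_inter_nonempty (hΔ : ∀ v, max (outDeg A v) (inDeg A v) ≤ Δ)
    (hω : 2 * (Δ + 1) < 3 * bicliqueNum A) {C D : Finset (Finset V)} {Q : Finset V}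
    (hQC : Q ∈ C) (hQD : Q ∈ D) (hC : ∀ P ∈ C, IsMaxBiclique A P)
    (hD : ∀ P ∈ D, IsMaxBiclique A P) (hCne : (commonPart C).Nonempty)
    (hDne : (commonPart D).Nonempty) : (commonPart C ∩ commonPart D).Nonempty := by
  have h₁ := two_mul_bicliqueNum_le_card_commonPart hΔ ⟨Q, hQC⟩ hC hCne
  have h₂ := two_mul_bicliqueNum_le_card_commonPart hΔ ⟨Q, hQD⟩ hD hDne
  have h₃ := card_union_add_card_inter (commonPart C) (commonPart D)
  have h₄ : #(commonPart C ∪ commonPart D) ≤ #Q := card_le_card <| union_subset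
    (fun v hv => mem_commonPart.1 hv Q hQC) (fun v hv => mem_commonPart.1 hv Q hQD)
  have h₅ := (hC Q hQC).2
  rw [← card_pos]
  omega

open Classical in
lemma not_disjoint_trans (hΔ : ∀ v, max (outDeg A v) (inDeg A v) ≤ Δ)
    (hω : 2 * (Δ + 1) < 3 * bicliqueNum A) {P Q R : Finset V} (hP : IsMaxBiclique A P)
    (hQ : IsMaxBiclique A Q) (hR : IsMaxBiclique A R) (hPQ : ¬ Disjoint P Q)
    (hQR : ¬ Disjoint Q R) : ¬ Disjoint P R := by
  obtain ⟨u, huP, huQ⟩ := not_disjoint_iff.1 hPQ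
  obtain ⟨w, hwQ, hwR⟩ := not_disjoint_iff.1 hQR
  obtain ⟨v, hv⟩ := commonPart_inter_nonempty hΔ hω (C := {P, Q}) (D := {Q, R}) (Q := Q)
    (by simp) (by simp) (by simp [hP, hQ]) (by simp [hQ, hR])
    ⟨u, by simp [mem_commonPart, huP, huQ]⟩ ⟨w, by simp [mem_commonPart, hwQ, hwR]⟩
  simp only [mem_inter, mem_commonPart] at hv
  exact not_disjoint_iff.2 ⟨v, hv.1 P (by simp), hv.2 R (by simp)⟩

/-- Kostochka's lemma for maximum bicliques. -/
lemma commonPart_nonempty (hΔ : ∀ v, max (outDeg A v) (inDeg A v) ≤ Δ)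
    (hω : 2 * (Δ + 1) < 3 * bicliqueNum A) {C : Finset (Finset V)} (hC : C.Nonempty)
    (hmax : ∀ Q ∈ C, IsMaxBiclique A Q) (hmeet : ∀ P ∈ C, ∀ Q ∈ C, ¬ Disjoint P Q) :
    (commonPart C).Nonempty := by
  classical
  induction hC using Finset.Nonempty.cons_induction with
  | singleton Q =>
    obtain ⟨v, hv, _⟩ := not_disjoint_iff.1 (hmeet Q (by simp) Q (by simp))
    exact ⟨v, by simpa [mem_commonPart] using hv⟩
  | cons Q C hQC hC ih =>
    have hmaxC : ∀ P ∈ C, IsMaxBiclique A P := fun P hP => hmax P (by simp [hP])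
    have hne := ih hmaxC fun P hP R hR => hmeet P (by simp [hP]) R (by simp [hR])
    obtain ⟨P, hP⟩ := hC
    obtain ⟨u, huQ, huP⟩ := not_disjoint_iff.1 (hmeet Q (by simp) P (by simp [hP]))
    obtain ⟨v, hv⟩ := commonPart_inter_nonempty hΔ hω (C := C) (D := {P, Q}) hP (by simp) hmaxC
      (by simp [hmaxC P hP, hmax Q (by simp)]) hne ⟨u, by simp [mem_commonPart, huP, huQ]⟩
    simp only [mem_inter, mem_commonPart] at hv
    refine ⟨v, mem_commonPart.2 fun R hR => ?_⟩
    rcases mem_cons.1 hR with rfl | hR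
    exacts [hv.2 R (by simp), hv.1 R hR]

/-- Some acyclic set meets every maximum biclique. -/
theorem exists_acyclic_hitting_set (hirr : ∀ v, ¬ A v v)
    (hΔ : ∀ v, max (outDeg A v) (inDeg A v) ≤ Δ) (hω : 2 * (Δ + 1) < 3 * bicliqueNum A) :
    ∃ I : Set V, AcyclicOn A I ∧ ∀ Q, IsMaxBiclique A Q → ∃ v ∈ Q, v ∈ I := by
  classical
  have hne : ∀ Q, IsMaxBiclique A Q → ¬ Disjoint Q Q := fun Q hQ h => by
    have h₁ := hQ.2
    rw [disjoint_self_iff_empty Q |>.1 h, card_empty] at h₁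
    omega
  let cluster : Finset V → Finset (Finset V) := fun Q => {P | IsMaxBiclique A P ∧ ¬ Disjoint Q P}
  let s : Finset (Finset (Finset V)) := ({Q | IsMaxBiclique A Q} : Finset (Finset V)).image cluster
  have hself : ∀ Q, IsMaxBiclique A Q → Q ∈ cluster Q := fun Q hQ => by
    exact mem_filter.2 ⟨mem_univ _, hQ, hne Q hQ⟩
  have hs : ∀ C ∈ s, ∃ Q, IsMaxBiclique A Q ∧ C = cluster Q := fun C hC => by
    obtain ⟨Q, hQ, rfl⟩ := mem_image.1 hC
    exact ⟨Q, by simpa using hQ, rfl⟩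
  have hmem : ∀ C ∈ s, ∀ P ∈ C, IsMaxBiclique A P := fun C hC P hP => by
    obtain ⟨Q, -, rfl⟩ := hs C hC
    exact (mem_filter.1 hP).2.1
  have hCne : ∀ C ∈ s, C.Nonempty := fun C hC => by
    obtain ⟨Q, hQ, rfl⟩ := hs C hC
    exact ⟨Q, hself Q hQ⟩
  have heq : ∀ C ∈ s, ∀ D ∈ s, ∀ P ∈ C, ∀ R ∈ D, ¬ Disjoint P R → C = D := by
    have hcl : ∀ P R, IsMaxBiclique A P → IsMaxBiclique A R → ¬ Disjoint P R →
        cluster P = cluster R := fun P R hP hR hPR => by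
      ext T
      simp only [cluster, mem_filter, mem_univ, true_and]
      refine and_congr_right fun hT => ⟨fun h => ?_, fun h => ?_⟩
      · exact not_disjoint_trans hΔ hω hR hP hT (fun h' => hPR h'.symm) h
      · exact not_disjoint_trans hΔ hω hP hR hT hPR h
    intro C hC D hD P hP R hR hPR
    have hPm := hmem C hC P hP
    have hRm := hmem D hD R hR
    obtain ⟨Q, hQ, rfl⟩ := hs C hC
    obtain ⟨Q', hQ', rfl⟩ := hs D hD
    rw [hcl Q P hQ hPm (mem_filter.1 hP).2.2, hcl Q' R hQ' hRm (mem_filter.1 hR).2.2,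
      hcl P R hPm hRm hPR]
  have hFne : ∀ C ∈ s, (commonPart C).Nonempty := by
    intro C hC
    refine commonPart_nonempty hΔ hω (hCne C hC) (hmem C hC) fun P hP R hR => ?_
    have hPm := hmem C hC P hP
    have hRm := hmem C hC R hR
    obtain ⟨Q, hQ, rfl⟩ := hs C hC
    exact not_disjoint_trans hΔ hω hPm hQ hRm (fun h => (mem_filter.1 hP).2.2 h.symm)
      (mem_filter.1 hR).2.2
  have hFU : ∀ C ∈ s, ∀ D ∈ s, ∀ v ∈ commonPart D, v ∈ C.biUnion id → C = D := by
    intro C hC D hD v hvD hvC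
    obtain ⟨P, hP, hvP⟩ := mem_biUnion.1 hvC
    obtain ⟨R, hR⟩ := hCne D hD
    exact heq C hC D hD P hP R hR (not_disjoint_iff.2 ⟨v, hvP, mem_commonPart.1 hvD R hR⟩)
  have hFsub : ∀ C ∈ s, commonPart C ⊆ C.biUnion id := fun C hC v hv => by
    obtain ⟨P, hP⟩ := hCne C hC
    exact mem_biUnion.2 ⟨P, hP, mem_commonPart.1 hv P hP⟩
  have hωU : ∀ C ∈ s, bicliqueNum A ≤ #(C.biUnion id) := fun C hC => by
    obtain ⟨P, hP⟩ := hCne C hC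
    rw [← (hmem C hC P hP).2]
    exact card_le_card (subset_biUnion_of_mem id hP)
  obtain ⟨R, hR⟩ : ∃ R : V → V → Prop, ∀ u v, R u v ↔ A u v ∧
      ∃ C ∈ s, ∃ D ∈ s, C ≠ D ∧ u ∈ commonPart C ∧ v ∈ commonPart D := ⟨_, fun _ _ => Iff.rfl⟩
  have hout : ∀ C ∈ s, ∀ v ∈ commonPart C, #{u | R v u} + #(C.biUnion id) ≤ Δ + 1 := by
    intro C hC v hv
    refine card_add_card_biUnion_le (card_filter_out_le hΔ v) (fun Q hQ => (hmem C hC Q hQ).1) hv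
      fun u hu => ?_
    obtain ⟨hr, C', hC', D, hD, hne', hvC', huD⟩ := (hR _ _).1 (mem_filter.1 hu).2
    refine ⟨hr, fun huC => hne' ?_⟩
    rw [← hFU C hC C' hC' v hvC' (hFsub C hC hv), hFU C hC D hD u huD huC]
  have hin : ∀ C ∈ s, ∀ v ∈ commonPart C, #{u | R u v} + #(C.biUnion id) ≤ Δ + 1 := by
    intro C hC v hv
    refine card_add_card_biUnion_le (B := fun x y => A y x) (card_filter_in_le hΔ v)
      (fun Q hQ u hu w hw huw => (hmem C hC Q hQ).1 w hw u hu huw.symm) hv fun u hu => ?_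
    obtain ⟨hr, D, hD, C', hC', hne', huD, hvC'⟩ := (hR _ _).1 (mem_filter.1 hu).2
    refine ⟨hr, fun huC => hne' ?_⟩
    rw [← hFU C hC C' hC' v hvC' (hFsub C hC hv), hFU C hC D hD u huD huC]
  have : Nonempty V := by
    obtain ⟨Q, hQ⟩ := exists_isBiclique_card_eq A
    obtain ⟨v, -⟩ := not_disjoint_iff.1 (hne Q hQ)
    exact ⟨v⟩
  obtain ⟨f, hf, hac⟩ := exists_acyclic_transversal (R := R) (F := commonPart)
    (k := Δ + 1 - bicliqueNum A) (fun v hv => hirr v ((hR v v).1 hv).1) s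
    (fun C hC D hD hCD => disjoint_left.2 fun v hvC hvD =>
      hCD (hFU C hC D hD v hvD (hFsub C hC hvC)))
    hFne
    (fun C hC v hv => by
      have h₁ := hout C hC v hv
      have h₂ := hωU C hC
      omega)
    (fun C hC v hv => by
      have h₁ := hin C hC v hv
      have h₂ := hωU C hC
      have h₃ := two_mul_bicliqueNum_le (hCne C hC) (hmem C hC)
      omega)
  refine ⟨f '' s, fun v hv => hac v (TransGen.mono ?_ _ _ hv), fun Q hQ => ?_⟩
  · rintro _ _ ⟨⟨C, hC, rfl⟩, ⟨D, hD, rfl⟩, hr⟩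
    refine ⟨⟨C, hC, rfl⟩, ⟨D, hD, rfl⟩,
      (hR _ _).2 ⟨hr, C, hC, D, hD, ?_, hf C hC, hf D hD⟩⟩
    rintro rfl
    exact hirr _ hr
  · have hQs : cluster Q ∈ s := mem_image_of_mem _ (by simpa using hQ)
    exact ⟨f (cluster Q), mem_commonPart.1 (hf _ hQs) Q (hself Q hQ), _, hQs, rfl⟩

end Degree

lemma AcyclicOn.eq_of_mem_isBiclique {I : Set V} (hI : AcyclicOn A I) {Q : Finset V}
    (hQ : IsBiclique A Q) {u v : V} (hu : u ∈ Q) (hv : v ∈ Q) (huI : u ∈ I) (hvI : v ∈ I) :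
    u = v := by
  by_contra huv
  exact hI u (.tail (.single ⟨huI, hvI, hQ u hu v hv huv⟩) ⟨hvI, huI, hQ v hv u hu (Ne.symm huv)⟩)

end Bicliques

theorem stmt_19 {V : Type*} [Fintype V] (A : V → V → Prop) (hirr : Irreflexive A)
    (hconn : ∀ u v : V, ReflTransGen (fun x y => A x y ∨ A y x) u v)
    (Δ : ℕ) (hΔ : ∀ v, max (outDeg A v) (inDeg A v) ≤ Δ)
    (hω : 2 * (Δ + 1) < 3 * bicliqueNum A) :
    ∃ I : Set V, AcyclicOn A I ∧ bicliqueNumOutside A I = bicliqueNum A - 1 := by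
  classical
  obtain ⟨I, hI, hhit⟩ := exists_acyclic_hitting_set (fun v hv => hirr v hv) hΔ hω
  refine ⟨I, hI, IsGreatest.csSup_eq ⟨?_, ?_⟩⟩
  · obtain ⟨Q, hQ, hcard⟩ := exists_isBiclique_card_eq A
    obtain ⟨v, hvQ, hvI⟩ := hhit Q ⟨hQ, hcard⟩
    refine ⟨Q.erase v, fun u hu w hw => hQ u (Finset.mem_of_mem_erase hu) w
      (Finset.mem_of_mem_erase hw), fun u hu huI => ?_, by
        rw [Finset.card_erase_of_mem hvQ, hcard]⟩
    exact Finset.ne_of_mem_erase hu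
      (hI.eq_of_mem_isBiclique hQ (Finset.mem_of_mem_erase hu) hvQ huI hvI)
  · rintro _ ⟨S, hS, hSI, rfl⟩
    have hle : S.card ≤ bicliqueNum A := IsBiclique.card_le hS
    have hne : S.card ≠ bicliqueNum A := fun h => by
      obtain ⟨v, hvS, hvI⟩ := hhit S ⟨hS, h⟩
      exact hSI v hvS hvI
    omega
end
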